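/- Let p ∈ ℝ[x_1,…,x_d] be a polynomial of degree m, and suppose there exist an integer n and complex Hermitian n×n matrices A_0, A_1, …, A_d with A_0 + x⁰_1 A_1 + ⋯ + x⁰_d A_d = I_n such that det(A_0 + x_1 A_1 + ⋯ + x_d A_d) = p(x). Then there exist an integer n' ≤ m·d and complex Hermitian n'×n' matrices B_0, B_1, …, B_d with B_0 + x⁰_1 B_1 + ⋯ + x⁰_d B_d = I_{n'} such that det(B_0 + x_1 B_1 + ⋯ + x_d B_d) = p(x). -/

import Mathlib

theorem finrank_biSup_le_sum {K V ι : Type*} [DivisionRing K] [AddCommGroup V] [Module K V]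
    [FiniteDimensional K V] (s : Finset ι) (W : ι → Submodule K V) :
    Module.finrank K (⨆ i ∈ s, W i : Submodule K V) ≤ ∑ i ∈ s, Module.finrank K (W i) := by
  classical
  induction s using Finset.induction_on with
  | empty => simp
  | insert a s ha ih =>
    rw [Finset.iSup_insert, Finset.sum_insert ha]
    exact (Submodule.finrank_add_le_finrank_add_finrank _ _).trans (by gcongr)

/-- The degree of `det (1 + X A)` for a Hermitian matrix `A` is the rank of `A`. -/
theorem Matrix.IsHermitian.natDegree_det_one_add_X_smul {ι : Type*} [Fintype ι] [DecidableEq ι]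
    {A : Matrix ι ι ℂ} (hA : A.IsHermitian) :
    (Matrix.det (1 + (Polynomial.X : Polynomial ℂ) • A.map Polynomial.C)).natDegree = A.rank := by
  have hdet : Matrix.det (1 + (Polynomial.X : Polynomial ℂ) • A.map Polynomial.C) =
      ∏ i, (Polynomial.C (hA.eigenvalues i : ℂ) * Polynomial.X + Polynomial.C 1) := by
    set U : Matrix ι ι ℂ := hA.eigenvectorUnitary.1
    have hUU : star U * U = 1 := Unitary.coe_star_mul_self hA.eigenvectorUnitary
    have hspec : A = U * (Matrix.diagonal (fun i => (hA.eigenvalues i : ℂ)) * star U) := by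
      conv_lhs => rw [hA.spectral_theorem, Unitary.conjStarAlgAut_apply, mul_assoc]
      rfl
    conv_lhs => rw [hspec]
    rw [Matrix.map_mul, ← Matrix.mul_smul, Matrix.det_one_add_mul_comm, Matrix.smul_mul,
      ← Matrix.map_mul, mul_assoc, hUU, mul_one]
    have : (1 + (Polynomial.X : Polynomial ℂ) •
        (Matrix.diagonal (fun i => (hA.eigenvalues i : ℂ))).map Polynomial.C) =
        Matrix.diagonal (fun i => Polynomial.C (hA.eigenvalues i : ℂ) * Polynomial.X +
          Polynomial.C 1) := by
      ext1 i j
      by_cases h : i = j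
      · subst h
        simp only [Matrix.add_apply, Matrix.smul_apply, Matrix.map_apply, Matrix.one_apply_eq,
          Matrix.diagonal_apply_eq, smul_eq_mul, map_one]
        ring
      · simp [h]
    rw [this, Matrix.det_diagonal]
  have hne (i : ι) :
      Polynomial.C (hA.eigenvalues i : ℂ) * Polynomial.X + Polynomial.C 1 ≠ 0 := fun h => by
    simpa using congrArg (Polynomial.eval 0) h
  rw [hdet, Polynomial.natDegree_prod _ _ fun i _ => hne i, hA.rank_eq_card_non_zero_eigs,
    Fintype.card_subtype, Finset.card_filter]
  refine Finset.sum_congr rfl fun i _ => ?_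
  split_ifs with h
  · exact Polynomial.natDegree_linear (by exact_mod_cast h)
  · simp [not_not.mp h]

theorem Matrix.map_linear_pencil_eq {d : ℕ} {ι : Type*} [Fintype ι] [DecidableEq ι]
    {x0 : Fin d → ℂ} {A0 : Matrix ι ι ℂ} {A : Fin d → Matrix ι ι ℂ}
    (hnorm : A0 + ∑ i, x0 i • A i = 1) :
    (Matrix.of fun k l => MvPolynomial.C (A0 k l) +
        ∑ i, MvPolynomial.X i * MvPolynomial.C (A i k l)) =
      1 + ∑ i, (MvPolynomial.X i - MvPolynomial.C (x0 i)) •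
        (A i).map (MvPolynomial.C (σ := Fin d)) := by
  ext1 k l
  have h := congrArg (fun M : Matrix ι ι ℂ => MvPolynomial.C (σ := Fin d) (M k l)) hnorm
  have h1 : MvPolynomial.C (σ := Fin d) ((1 : Matrix ι ι ℂ) k l) =
      (1 : Matrix ι ι (MvPolynomial (Fin d) ℂ)) k l := by
    simp [Matrix.one_apply, apply_ite]
  rw [Matrix.add_apply, ← h1, ← h]
  simp [Matrix.sum_apply, sub_mul, Finset.sum_sub_distrib]

/-- The coefficients of a normalized Hermitian pencil have rank at most the total degree of its
determinant: restrict the pencil to a coordinate line through `x0`. -/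
theorem Matrix.rank_le_totalDegree_det_pencil {d : ℕ} {ι : Type*} [Fintype ι] [DecidableEq ι]
    (x0 : Fin d → ℂ) {A : Fin d → Matrix ι ι ℂ} (hA : ∀ i, (A i).IsHermitian) (j : Fin d) :
    (A j).rank ≤ (Matrix.det (1 + ∑ i, (MvPolynomial.X i - MvPolynomial.C (x0 i)) •
        (A i).map (MvPolynomial.C (σ := Fin d)))).totalDegree := by
  set q := Matrix.det (1 + ∑ i, (MvPolynomial.X i - MvPolynomial.C (x0 i)) •
        (A i).map (MvPolynomial.C (σ := Fin d)))
  let f : Fin d → Polynomial ℂ := fun i =>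
    if i = j then Polynomial.X + Polynomial.C (x0 i) else Polynomial.C (x0 i)
  have hf (i : Fin d) : (f i).natDegree ≤ 1 := by
    by_cases h : i = j <;> simp [f, h]
  have hq : MvPolynomial.aeval f q =
      Matrix.det (1 + (Polynomial.X : Polynomial ℂ) • (A j).map Polynomial.C) := by
    rw [AlgHom.map_det]
    congr 1
    rw [map_add, map_one, map_sum, Finset.sum_eq_single j]
    · ext1 k l
      simp [f, Polynomial.C_eq_algebraMap]
    · intro i _ hij
      ext1 k l
      simp [f, hij, Polynomial.C_eq_algebraMap]
    · simp
  rw [← (hA j).natDegree_det_one_add_X_smul, ← hq]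
  simpa using MvPolynomial.aeval_natDegree_le q le_rfl f hf

/-- Matrices whose ranks are bounded by `m` are all fixed by the orthogonal projection `U Uᴴ` onto
the sum of their ranges, which has dimension at most `m * d`. -/
theorem Matrix.exists_mul_conjTranspose_mul_eq {d m : ℕ} {ι : Type*} [Fintype ι] [DecidableEq ι]
    (A : Fin d → Matrix ι ι ℂ) (hrank : ∀ i, (A i).rank ≤ m) :
    ∃ r ≤ m * d, ∃ U : Matrix ι (Fin r) ℂ, ∀ i, U * (U.conjTranspose * A i) = A i := by
  let W : Fin d → Submodule ℂ (EuclideanSpace ℂ ι) := fun i =>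
    LinearMap.range (Matrix.toEuclideanLin (A i))
  let V : Submodule ℂ (EuclideanSpace ℂ ι) := ⨆ i ∈ Finset.univ, W i
  have hW (i : Fin d) : Module.finrank ℂ (W i) ≤ m := by
    refine le_trans (le_of_eq ?_) (hrank i)
    rw [Matrix.rank_eq_finrank_range_toLin (A i) (PiLp.basisFun 2 ℂ ι) (PiLp.basisFun 2 ℂ ι),
      ← Matrix.toLpLin_eq_toLin]
  let b := stdOrthonormalBasis ℂ V
  refine ⟨Module.finrank ℂ V, ?_, Matrix.of fun k j => (b j : EuclideanSpace ℂ ι) k, fun i => ?_⟩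
  · refine (finrank_biSup_le_sum _ _).trans
      ((Finset.sum_le_card_nsmul _ _ m fun i _ => hW i).trans ?_)
    simp [mul_comm]
  · ext1 k l
    let v : EuclideanSpace ℂ ι := WithLp.toLp 2 ((A i).col l)
    have hv : v ∈ V := by
      refine Submodule.mem_iSup_of_mem i (Submodule.mem_iSup_of_mem (Finset.mem_univ i) ?_)
      refine ⟨WithLp.toLp 2 (Pi.single l 1), ?_⟩
      simp [v, Matrix.toLpLin_apply]
    have hsum := congrArg (fun w : V => (w : EuclideanSpace ℂ ι) k) (b.sum_repr' ⟨v, hv⟩)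
    have hvk : v k = A i k l := rfl
    rw [← hvk]
    refine Eq.trans ?_ hsum
    simp [Matrix.mul_apply, v, PiLp.inner_apply, mul_comm]


/-- Compressing the matrices `A i` does not change `det (1 + ∑ i, c i • A i)` as long as `U * V`
fixes them all. -/
theorem Matrix.det_one_add_sum_smul_map_mul {R S ι κ l : Type*} [CommRing R] [CommRing S]
    [Fintype ι] [DecidableEq ι] [Fintype κ] [DecidableEq κ] [Fintype l] (f : R →+* S) (c : l → S)
    (U : Matrix ι κ R) (V : Matrix κ ι R) (A : l → Matrix ι ι R)
    (hUV : ∀ i, U * (V * A i) = A i) :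
    Matrix.det (1 + ∑ i, c i • (V * A i * U).map f) = Matrix.det (1 + ∑ i, c i • (A i).map f) := by
  let N : Matrix κ ι S := ∑ i, c i • (V * A i).map f
  have hfactor : ∑ i, c i • (V * A i * U).map f = N * U.map f := by
    rw [Matrix.sum_mul]
    exact Finset.sum_congr rfl fun i _ => by rw [Matrix.map_mul, Matrix.smul_mul]
  have hN : U.map f * N = ∑ i, c i • (A i).map f := by
    rw [Matrix.mul_sum]
    exact Finset.sum_congr rfl fun i _ => by rw [Matrix.mul_smul, ← Matrix.map_mul, hUV]
  rw [hfactor, Matrix.det_one_add_mul_comm, hN]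

open MvPolynomial in
/-- If a polynomial `p ∈ ℝ[x_1,…,x_d]` of degree `m` admits a self-adjoint
determinantal representation normalized to `I` at `x⁰`, then it admits one of size
`n' ≤ m·d`. -/
theorem stmt13 {d n m : ℕ} (p : MvPolynomial (Fin d) ℝ) (x0 : Fin d → ℝ)
    (hdeg : p.totalDegree = m)
    (A0 : Matrix (Fin n) (Fin n) ℂ) (A : Fin d → Matrix (Fin n) (Fin n) ℂ)
    (hA0 : A0.IsHermitian) (hA : ∀ i, (A i).IsHermitian)
    (hnorm : A0 + ∑ i, (x0 i : ℂ) • A i = 1)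
    (hdet : Matrix.det (Matrix.of fun k l =>
        C (A0 k l) + ∑ i, X i * C (A i k l)) =
      MvPolynomial.map (algebraMap ℝ ℂ) p) :
    ∃ n' : ℕ, n' ≤ m * d ∧
      ∃ (B0 : Matrix (Fin n') (Fin n') ℂ) (B : Fin d → Matrix (Fin n') (Fin n') ℂ),
        B0.IsHermitian ∧ (∀ i, (B i).IsHermitian) ∧
        B0 + ∑ i, (x0 i : ℂ) • B i = 1 ∧
        Matrix.det (Matrix.of fun k l =>
            C (B0 k l) + ∑ i, X i * C (B i k l)) =
          MvPolynomial.map (algebraMap ℝ ℂ) p := by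
  have hpencil := Matrix.map_linear_pencil_eq (x0 := fun i => (x0 i : ℂ)) hnorm
  rw [hpencil] at hdet
  have hrank (i : Fin d) : (A i).rank ≤ m := by
    refine (Matrix.rank_le_totalDegree_det_pencil (fun i => (x0 i : ℂ)) hA i).trans ?_
    rw [hdet, ← hdeg]
    exact Finset.sup_mono (MvPolynomial.support_map_subset _ _)
  obtain ⟨r, hr, U, hU⟩ := Matrix.exists_mul_conjTranspose_mul_eq A hrank
  have hB (i : Fin d) : (U.conjTranspose * A i * U).IsHermitian :=
    Matrix.isHermitian_conjTranspose_mul_mul U (hA i)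
  have hnormB : (1 - ∑ i, (x0 i : ℂ) • (U.conjTranspose * A i * U)) +
      ∑ i, (x0 i : ℂ) • (U.conjTranspose * A i * U) = 1 := sub_add_cancel _ _
  refine ⟨r, hr, _, fun i => U.conjTranspose * A i * U, ?_, hB, hnormB, ?_⟩
  · refine Matrix.isHermitian_one.sub ?_
    simp [Matrix.IsHermitian, Matrix.conjTranspose_sum, Matrix.conjTranspose_smul, (hB _).eq]
  · rw [Matrix.map_linear_pencil_eq (x0 := fun i => (x0 i : ℂ)) hnormB, ← hdet]
    exact Matrix.det_one_add_sum_smul_map_mul C _ U U.conjTranspose A hU
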